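/- Let λ = (λ_1, …, λ_k), k ≥ 4, be a k-net of order n embedded in PG(2,K) such that all lines of λ_1 pass through a common point. If some other component λ_j (j ≥ 2) also has all its lines passing through a common point, then every component λ_i (1 ≤ i ≤ k) has all its lines passing through a common point Q_i, and the k base points Q_1, …, Q_k are collinear. -/

import Mathlib

/-- The point set of the projective plane `PG(2,K)`. -/
abbrev PGPoint (K : Type*) [Field K] := Projectivization K (Fin 3 → K)

/-- The line set of `PG(2,K)`, a line being given by its dual (homogeneous)
coordinates, i.e. by a nonzero linear form up to a scalar. -/
abbrev PGLine (K : Type*) [Field K] := Projectivization K (Fin 3 → K)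

/-- Incidence between a point and a line of `PG(2,K)`. -/
def Incident {K : Type*} [Field K] (P : PGPoint K) (l : PGLine K) : Prop :=
  ∑ i, P.rep i * l.rep i = 0

/-- The cross-ratio of four (distinct, concurrent) lines of `PG(2,K)`, taken in this
order, equals `κ`:  if the first two lines have equations `r = 0` and `w = 0`, and the
other two have equations `σ•r + τ•w = 0` and `δ•r + ω•w = 0`, the cross-ratio is
`(τ/σ)·(δ/ω)`. -/
def CrossRatioLines {K : Type*} [Field K] (l₁ l₂ l₃ l₄ : PGLine K) (κ : K) : Prop :=
  ∃ (r w : Fin 3 → K) (σ τ δ ω : K) (hr : r ≠ 0) (hw : w ≠ 0)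
    (h₃ : σ • r + τ • w ≠ 0) (h₄ : δ • r + ω • w ≠ 0),
    σ ≠ 0 ∧ τ ≠ 0 ∧ δ ≠ 0 ∧ ω ≠ 0 ∧
    l₁ = Projectivization.mk K r hr ∧ l₂ = Projectivization.mk K w hw ∧
    l₃ = Projectivization.mk K (σ • r + τ • w) h₃ ∧
    l₄ = Projectivization.mk K (δ • r + ω • w) h₄ ∧
    κ = (τ / σ) * (δ / ω)

/-- A `k`-net of order `n` embedded in `PG(2,K)`: `k` pairwise disjoint sets of lines
(the components), each of size `n`, such that any two lines from distinct components
meet in a point through which passes exactly one line of each of the `k` components. -/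
structure IsNet (K : Type*) [Field K] (k n : ℕ) (Λ : Fin k → Finset (PGLine K)) : Prop where
  card_eq : ∀ i, (Λ i).card = n
  disj : ∀ i j, i ≠ j → Disjoint (Λ i) (Λ j)
  meets : ∀ i j, i ≠ j → ∀ l₁ ∈ Λ i, ∀ l₂ ∈ Λ j,
    ∃ P : PGPoint K, Incident P l₁ ∧ Incident P l₂ ∧
      ∀ m, ∃! l, l ∈ Λ m ∧ Incident P l

/-- A point of the net: a point lying on two lines from distinct components. -/
def IsNetPoint {K : Type*} [Field K] {k : ℕ} (Λ : Fin k → Finset (PGLine K))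
    (P : PGPoint K) : Prop :=
  ∃ i j, i ≠ j ∧ ∃ l₁ ∈ Λ i, ∃ l₂ ∈ Λ j, Incident P l₁ ∧ Incident P l₂

/-- A 4-net has constant cross-ratio `κ` if for every point `P` of the net, the
cross-ratio of the four lines of the net through `P`, taken in the component order,
equals `κ`. -/
def HasConstantCrossRatio {K : Type*} [Field K] (Λ : Fin 4 → Finset (PGLine K)) (κ : K) : Prop :=
  ∀ P : PGPoint K, IsNetPoint Λ P →
    ∀ l₁ ∈ Λ 0, ∀ l₂ ∈ Λ 1, ∀ l₃ ∈ Λ 2, ∀ l₄ ∈ Λ 3,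
      Incident P l₁ → Incident P l₂ → Incident P l₃ → Incident P l₄ →
        CrossRatioLines l₁ l₂ l₃ l₄ κ

theorem aux_prod_erase {α β K : Type*} [Field K] [DecidableEq α] [DecidableEq β]
    (A : Finset α) (B : Finset β) (T : α → β → Prop)
    (h1 : ∀ a ∈ A, ∃! b, b ∈ B ∧ T a b) (h2 : ∀ b ∈ B, ∃! a, a ∈ A ∧ T a b)
    (a0 : α) (b0 : β) (ha0 : a0 ∈ A) (hb0 : b0 ∈ B) (h0 : T a0 b0) (f : α → K) (g : β → K)
    (hfg : ∀ a ∈ A, ∀ b ∈ B, T a b → f a = g b) :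
    ∏ a ∈ A.erase a0, f a = ∏ b ∈ B.erase b0, g b := by
  have : Nonempty β := ⟨b0⟩
  choose! F hF hF' using h1
  refine Finset.prod_bij (fun a _ => F a) ?_ ?_ ?_ ?_
  · intro a ha
    rw [Finset.mem_erase] at ha ⊢
    refine ⟨fun h => ha.1 ?_, (hF a ha.2).1⟩
    exact (h2 b0 hb0).unique ⟨ha.2, h ▸ (hF a ha.2).2⟩ ⟨ha0, h0⟩
  · intro a ha a' ha' h
    have ha := Finset.mem_of_mem_erase ha
    have ha' := Finset.mem_of_mem_erase ha'
    exact (h2 (F a) (hF a ha).1).unique ⟨ha, (hF a ha).2⟩ ⟨ha', h ▸ (hF a' ha').2⟩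
  · intro b hb
    rw [Finset.mem_erase] at hb
    obtain ⟨a, ⟨ha, hT⟩, -⟩ := h2 b hb.2
    have e : F a = b := (hF' a ha b ⟨hb.2, hT⟩).symm
    refine ⟨a, Finset.mem_erase.2 ⟨?_, ha⟩, e⟩
    rintro rfl
    exact hb.1 (e ▸ (hF' a ha b0 ⟨hb0, h0⟩).symm)
  · intro a ha
    have ha := Finset.mem_of_mem_erase ha
    exact hfg a ha _ (hF a ha).1 (hF a ha).2

theorem aux_slope {α K : Type*} [Field K] [DecidableEq α]
    (A B C : Finset α) (R : α → α → α → Prop) (u v s c : α → K)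
    (h0 : ∀ y ∈ C, s y ≠ 0)
    (hAB : ∀ a ∈ A, ∀ b ∈ B, ∃! x, x ∈ C ∧ R a b x)
    (hAC : ∀ a ∈ A, ∀ x ∈ C, ∃! b, b ∈ B ∧ R a b x)
    (hBC : ∀ b ∈ B, ∀ x ∈ C, ∃! a, a ∈ A ∧ R a b x)
    (hR : ∀ a ∈ A, ∀ b ∈ B, ∀ x ∈ C, R a b x → v b = c x - s x * u a)
    (a b x : α) (ha : a ∈ A) (hb : b ∈ B) (hx : x ∈ C) (h : R a b x) :
    (∏ b' ∈ B.erase b, (v b' - v b)) * s x =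
      (∏ y ∈ C, s y) * ∏ a' ∈ A.erase a, (u a' - u a) := by
  have e1 : ∏ y ∈ C.erase x, (c y - s y * u a - v b) = ∏ b' ∈ B.erase b, (v b' - v b) := by
    refine aux_prod_erase C B (fun y b' => R a b' y) (hAC a ha) (hAB a ha) x b hx hb h _ _ ?_
    intro y hy b' hb' hh
    rw [hR a ha b' hb' y hy hh]
  have e2 : ∏ y ∈ C.erase x, (c y - s y * u a - v b) / s y =
      ∏ a' ∈ A.erase a, (u a' - u a) := by
    refine aux_prod_erase C A (fun y a' => R a' b y) (hBC b hb) (fun a' ha' => hAB a' ha' b hb)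
      x a hx ha h _ _ ?_
    intro y hy a' ha' hh
    have := h0 y hy
    rw [hR a' ha' b hb y hy hh]
    field_simp
    ring
  rw [Finset.prod_div_distrib] at e2
  have h3 : ∏ y ∈ C.erase x, s y ≠ 0 :=
    Finset.prod_ne_zero_iff.2 fun y hy => h0 y (Finset.mem_of_mem_erase hy)
  rw [div_eq_iff h3] at e2
  rw [← e1, e2, ← Finset.mul_prod_erase C s hx]
  ring

theorem aux_inc {K : Type*} [Field K] (P : PGPoint K) (l : PGLine K) :
    Incident P l ↔ P.orthogonal l := by
  conv_rhs => rw [← P.mk_rep, ← l.mk_rep]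
  rw [Projectivization.orthogonal_mk]
  rfl

theorem aux_inc_mk {K : Type*} [Field K] (v : Fin 3 → K) (hv : v ≠ 0) (l : PGLine K) :
    Incident (Projectivization.mk K v hv) l ↔ v ⬝ᵥ l.rep = 0 := by
  rw [aux_inc]
  conv_lhs => rw [← l.mk_rep]
  rw [Projectivization.orthogonal_mk]

theorem aux_two {K : Type*} [Field K] {P P' : PGPoint K} {l l' : PGLine K} (h1 : Incident P l)
    (h2 : Incident P' l) (h3 : Incident P l') (h4 : Incident P' l') : P = P' ∨ l = l' := by
  classical
  rw [aux_inc] at *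
  exact Configuration.Nondegenerate.eq_or_eq (P := PGPoint K) (L := PGLine K) h1 h2 h3 h4

theorem aux_line {K : Type*} [Field K] (P P' : PGPoint K) :
    ∃ l : PGLine K, Incident P l ∧ Incident P' l := by
  classical
  simp only [aux_inc]
  by_cases h : P = P'
  · subst h
    obtain ⟨w, hw⟩ := P.exists_not_self_orthogonal
    by_cases h : w = P
    · subst h
      have h1 : ∃ v : Fin 3 → K, v ≠ 0 ∧ w.rep ⬝ᵥ v = 0 := by
        by_cases h0 : w.rep 0 = 0
        · exact ⟨![1, 0, 0], by simp, by simp [dotProduct, Fin.sum_univ_three, h0]⟩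
        · refine ⟨![w.rep 1, - w.rep 0, 0], by simp [h0], ?_⟩
          simp [dotProduct, Fin.sum_univ_three]
          ring
      obtain ⟨v, hv, h2⟩ := h1
      refine ⟨Projectivization.mk K v hv, ?_⟩
      rw [and_self, Projectivization.orthogonal_comm]
      rw [← aux_inc, aux_inc_mk, dotProduct_comm]
      exact h2
    · exact ⟨_, Projectivization.orthogonal_cross_right h,
        Projectivization.orthogonal_cross_right h⟩
  · exact ⟨_, Projectivization.orthogonal_cross_left h, Projectivization.orthogonal_cross_right h⟩

theorem aux_not {K : Type*} [Field K] {k n : ℕ} {Λ : Fin k → Finset (PGLine K)}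
    (hnet : IsNet K k n Λ) (hn : 2 ≤ n) {i m : Fin k} (him : i ≠ m) {Q : PGPoint K}
    (hQ : ∀ l ∈ Λ i, Incident Q l) {l : PGLine K} (hl : l ∈ Λ m) : ¬ Incident Q l := by
  intro h
  have hc : 1 < (Λ i).card := by rw [hnet.card_eq]; omega
  obtain ⟨a, ha, b, hb, hab⟩ := Finset.one_lt_card.1 hc
  obtain ⟨P, h1, h2, h3⟩ := hnet.meets i m him a ha l hl
  rcases aux_two h1 (hQ a ha) h2 h with e | e
  · subst e
    exact hab ((h3 i).unique ⟨ha, hQ a ha⟩ ⟨hb, hQ b hb⟩)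
  · subst e
    exact Finset.disjoint_left.1 (hnet.disj i m him) ha hl

/-- concurrency at a net point -/
def AuxR {K : Type*} [Field K] {k : ℕ} (Λ : Fin k → Finset (PGLine K)) (a b c : PGLine K) : Prop :=
  ∃ P : PGPoint K, (∀ m, ∃! l, l ∈ Λ m ∧ Incident P l) ∧
    Incident P a ∧ Incident P b ∧ Incident P c

theorem aux_uniq {K : Type*} [Field K] {k n : ℕ} {Λ : Fin k → Finset (PGLine K)}
    (hnet : IsNet K k n Λ) {i j m : Fin k} (hij : i ≠ j) {a b : PGLine K} (ha : a ∈ Λ i)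
    (hb : b ∈ Λ j) : ∃! x, x ∈ Λ m ∧ AuxR Λ a b x := by
  obtain ⟨P, h1, h2, h3⟩ := hnet.meets i j hij a ha b hb
  obtain ⟨x, hx, hx'⟩ := h3 m
  refine ⟨x, ⟨hx.1, P, h3, h1, h2, hx.2⟩, ?_⟩
  rintro y ⟨hy, P', -, h1', h2', h4⟩
  rcases aux_two h1 h1' h2 h2' with e | e
  · subst e
    exact hx' y ⟨hy, h4⟩
  · subst e
    exact absurd hb (Finset.disjoint_left.1 (hnet.disj i j hij) ha)

theorem aux_basis {K : Type*} [Field K] {P P' : PGPoint K} (h : P ≠ P') :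
    ∃ e : Fin 3 → K, (Matrix.of ![P.rep, P'.rep, e]).det ≠ 0 := by
  have hc : crossProduct P.rep P'.rep ≠ 0 := by
    intro h0
    apply h
    rw [← P.mk_rep, ← P'.mk_rep]
    exact (Projectivization.mk_eq_mk_iff_crossProduct_eq_zero P.rep_nonzero P'.rep_nonzero).2 h0
  obtain ⟨i, hi⟩ := Function.ne_iff.1 hc
  refine ⟨Pi.single i 1, fun h0 => hi ?_⟩
  fin_cases i <;> simp [Matrix.det_fin_three, cross_apply] at h0 ⊢ <;> linear_combination h0

theorem aux_conc {K : Type*} [Field K] (P a b c q r e : Fin 3 → K) (hP : P ≠ 0)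
    (ha : P ⬝ᵥ a = 0) (hb : P ⬝ᵥ b = 0) (hc : P ⬝ᵥ c = 0) (h1 : q ⬝ᵥ a = 0) (h2 : r ⬝ᵥ b = 0) :
    (r ⬝ᵥ a) * ((q ⬝ᵥ b) * (e ⬝ᵥ c) - (e ⬝ᵥ b) * (q ⬝ᵥ c)) =
      (e ⬝ᵥ a) * (q ⬝ᵥ b) * (r ⬝ᵥ c) := by
  have hd : (Matrix.of ![a, b, c]).det = 0 := by
    by_contra h
    apply hP
    apply Matrix.eq_zero_of_mulVec_eq_zero h
    ext i
    fin_cases i <;> simp [Matrix.mulVec, dotProduct_comm _ P, ha, hb, hc]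
  have hd2 : (Matrix.of ![a, b, c] * (Matrix.of ![q, r, e]).transpose).det = 0 := by
    rw [Matrix.det_mul, hd, zero_mul]
  have hd3 : (q ⬝ᵥ a) * ((r ⬝ᵥ b) * (e ⬝ᵥ c) - (e ⬝ᵥ b) * (r ⬝ᵥ c))
      - (r ⬝ᵥ a) * ((q ⬝ᵥ b) * (e ⬝ᵥ c) - (e ⬝ᵥ b) * (q ⬝ᵥ c))
      + (e ⬝ᵥ a) * ((q ⬝ᵥ b) * (r ⬝ᵥ c) - (r ⬝ᵥ b) * (q ⬝ᵥ c)) = 0 := by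
    rw [← hd2, Matrix.det_fin_three]
    simp [Matrix.mul_apply, dotProduct, Fin.sum_univ_three]
    ring
  linear_combination -hd3 + h1 * ((r ⬝ᵥ b) * (e ⬝ᵥ c) - (e ⬝ᵥ b) * (r ⬝ᵥ c)) -
    h2 * (e ⬝ᵥ a) * (q ⬝ᵥ c)

theorem aux_inj {K : Type*} [Field K] (q r e : Fin 3 → K)
    (hM : (Matrix.of ![q, r, e]).det ≠ 0) (l l' : PGLine K) (h1 : r ⬝ᵥ l.rep = 0)
    (h2 : r ⬝ᵥ l'.rep = 0) (h3 : q ⬝ᵥ l.rep ≠ 0) (h4 : q ⬝ᵥ l'.rep ≠ 0)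
    (h : (e ⬝ᵥ l.rep) / (q ⬝ᵥ l.rep) = (e ⬝ᵥ l'.rep) / (q ⬝ᵥ l'.rep)) : l = l' := by
  have hw : (q ⬝ᵥ l'.rep) • l.rep - (q ⬝ᵥ l.rep) • l'.rep = 0 := by
    apply Matrix.eq_zero_of_mulVec_eq_zero hM
    rw [div_eq_div_iff h3 h4] at h
    ext i
    fin_cases i
    · simp [Matrix.mulVec, dotProduct_sub, dotProduct_smul]
      ring
    · simp [Matrix.mulVec, dotProduct_sub, dotProduct_smul, h1, h2]
    · simp [Matrix.mulVec, dotProduct_sub, dotProduct_smul]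
      linear_combination h
  rw [← l.mk_rep, ← l'.mk_rep, Projectivization.mk_eq_mk_iff']
  refine ⟨(q ⬝ᵥ l'.rep)⁻¹ * (q ⬝ᵥ l.rep), ?_⟩
  rw [mul_smul, ← sub_eq_zero.1 hw, smul_smul, inv_mul_cancel₀ h4, one_smul]

theorem aux_const {K : Type*} [Field K] {k n : ℕ} {Λ : Fin k → Finset (PGLine K)}
    (hnet : IsNet K k n Λ) (hn : 2 ≤ n) {i j m m' : Fin k} (hij : i ≠ j) (him : i ≠ m)
    (hjm : j ≠ m) (him' : i ≠ m') (hjm' : j ≠ m') (hmm : m ≠ m') {Q Q' : PGPoint K}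
    (hQ : ∀ l ∈ Λ i, Incident Q l) (hQ' : ∀ l ∈ Λ j, Incident Q' l) (hQQ : Q ≠ Q') :
    ∃ S T : K, T ≠ 0 ∧ ∀ x ∈ Λ m, ∀ y ∈ Λ m',
      (Q'.rep ⬝ᵥ x.rep) / (Q.rep ⬝ᵥ x.rep) * T = (Q'.rep ⬝ᵥ y.rep) / (Q.rep ⬝ᵥ y.rep) * S := by
  classical
  obtain ⟨e, he⟩ := aux_basis hQQ
  have nQ : ∀ m, i ≠ m → ∀ l ∈ Λ m, Q.rep ⬝ᵥ l.rep ≠ 0 := fun m h l hl =>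
    aux_not hnet hn h hQ hl
  have nQ' : ∀ m, j ≠ m → ∀ l ∈ Λ m, Q'.rep ⬝ᵥ l.rep ≠ 0 := fun m h l hl =>
    aux_not hnet hn h hQ' hl
  let u : PGLine K → K := fun l => (e ⬝ᵥ l.rep) / (Q'.rep ⬝ᵥ l.rep)
  let v : PGLine K → K := fun l => (e ⬝ᵥ l.rep) / (Q.rep ⬝ᵥ l.rep)
  let s : PGLine K → K := fun l => (Q'.rep ⬝ᵥ l.rep) / (Q.rep ⬝ᵥ l.rep)
  have hs : ∀ m, i ≠ m → j ≠ m → ∀ l ∈ Λ m, s l ≠ 0 := fun m h h' l hl =>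
    div_ne_zero (nQ' m h' l hl) (nQ m h l hl)
  have key : ∀ m, i ≠ m → j ≠ m → ∀ a ∈ Λ i, ∀ b ∈ Λ j, ∀ x ∈ Λ m, AuxR Λ a b x →
      (∏ b' ∈ (Λ j).erase b, (v b' - v b)) * s x =
      (∏ y ∈ Λ m, s y) * ∏ a' ∈ (Λ i).erase a, (u a' - u a) := by
    intro m hi hj a ha b hb x hx h
    refine aux_slope (Λ i) (Λ j) (Λ m) (AuxR Λ) u v s v (hs m hi hj) ?_ ?_ ?_ ?_ a b x ha hb hx h
    · intro a ha b hb
      exact aux_uniq hnet hij ha hb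
    · intro a ha x hx
      obtain ⟨b, hb, hb'⟩ := aux_uniq (m := j) hnet hi ha hx
      obtain ⟨h1, P, hP, h2, h3, h4⟩ := hb
      refine ⟨b, ⟨h1, P, hP, h2, h4, h3⟩, ?_⟩
      rintro y ⟨hy, P, hP, h2, h3, h4⟩
      exact hb' y ⟨hy, P, hP, h2, h4, h3⟩
    · intro a ha x hx
      obtain ⟨b, hb, hb'⟩ := aux_uniq (m := i) hnet hj ha hx
      obtain ⟨h1, P, hP, h2, h3, h4⟩ := hb
      refine ⟨b, ⟨h1, P, hP, h4, h2, h3⟩, ?_⟩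
      rintro y ⟨hy, P, hP, h2, h3, h4⟩
      exact hb' y ⟨hy, P, hP, h3, h4, h2⟩
    · rintro a ha b hb x hx ⟨P, hP, h2, h3, h4⟩
      have := aux_conc P.rep a.rep b.rep x.rep Q.rep Q'.rep e P.rep_nonzero h2 h3 h4
        (hQ a ha) (hQ' b hb)
      have n1 := nQ' i hij.symm a ha
      have n2 := nQ j hij b hb
      have n3 := nQ m hi x hx
      simp only [u, v, s]
      field_simp
      linear_combination -this
  refine ⟨∏ y ∈ Λ m, s y, ∏ y ∈ Λ m', s y, Finset.prod_ne_zero_iff.2 (hs m' him' hjm'), ?_⟩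
  intro x hx y hy
  obtain ⟨P, h1, h2, h3⟩ := hnet.meets m m' hmm x hx y hy
  obtain ⟨a, ⟨ha, haP⟩, -⟩ := h3 i
  obtain ⟨b, ⟨hb, hbP⟩, -⟩ := h3 j
  have k1 := key m him hjm a ha b hb x hx ⟨P, h3, haP, hbP, h1⟩
  have k2 := key m' him' hjm' a ha b hb y hy ⟨P, h3, haP, hbP, h2⟩
  have hE : ∏ b' ∈ (Λ j).erase b, (v b' - v b) ≠ 0 := by
    refine Finset.prod_ne_zero_iff.2 fun b' hb' => ?_
    rw [Finset.mem_erase] at hb'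
    refine fun h0 => hb'.1 ?_
    exact aux_inj Q.rep Q'.rep e he b' b (hQ' b' hb'.2) (hQ' b hb) (nQ j hij b' hb'.2)
      (nQ j hij b hb) (sub_eq_zero.1 h0)
  apply mul_left_cancel₀ hE
  change _ * (s x * _) = _ * (s y * _)
  linear_combination (∏ y ∈ Λ m', s y) * k1 - (∏ y ∈ Λ m, s y) * k2

theorem aux_base {K : Type*} [Field K] {k n : ℕ} (hk : 4 ≤ k) {Λ : Fin k → Finset (PGLine K)}
    (hnet : IsNet K k n Λ) (hn : 2 ≤ n) {i j m : Fin k} (hij : i ≠ j) (him : i ≠ m)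
    (hjm : j ≠ m) {Q Q' : PGPoint K} (g : PGLine K) (hg : Incident Q g) (hg' : Incident Q' g)
    (hQ : ∀ l ∈ Λ i, Incident Q l) (hQ' : ∀ l ∈ Λ j, Incident Q' l) (hQQ : Q ≠ Q') :
    ∃ R : PGPoint K, (∀ l ∈ Λ m, Incident R l) ∧ Incident R g := by
  obtain ⟨m', hm'⟩ : ∃ m', m' ∉ ({i, j, m} : Finset (Fin k)) := by
    by_contra! h
    have h1 : (Finset.univ : Finset (Fin k)) ⊆ {i, j, m} := fun x _ => h x
    have h2 := (Finset.card_le_card h1).trans Finset.card_le_three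
    rw [Finset.card_univ, Fintype.card_fin] at h2
    omega
  simp only [Finset.mem_insert, Finset.mem_singleton, not_or] at hm'
  obtain ⟨S, T, hT, h⟩ := aux_const hnet hn hij him hjm (Ne.symm hm'.1) (Ne.symm hm'.2.1)
    (Ne.symm hm'.2.2) hQ hQ' hQQ
  have ne : ∀ m, (Λ m).Nonempty := fun m => by
    rw [← Finset.card_pos, hnet.card_eq]; omega
  obtain ⟨y, hy⟩ := ne m'
  set t := (Q'.rep ⬝ᵥ y.rep) / (Q.rep ⬝ᵥ y.rep) * S / T with ht
  have hv : Q'.rep - t • Q.rep ≠ 0 := by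
    intro h0
    apply hQQ
    symm
    rw [← Q.mk_rep, ← Q'.mk_rep, Projectivization.mk_eq_mk_iff']
    exact ⟨t, (sub_eq_zero.1 h0).symm⟩
  refine ⟨Projectivization.mk K _ hv, fun l hl => ?_, ?_⟩
  · rw [aux_inc_mk, sub_dotProduct, smul_dotProduct, smul_eq_mul]
    have h1 := h l hl y hy
    have h2 : Q.rep ⬝ᵥ l.rep ≠ 0 := aux_not hnet hn him hQ hl
    rw [← eq_div_iff hT, ← ht, div_eq_iff h2] at h1
    rw [h1, sub_self]
  · rw [aux_inc_mk, sub_dotProduct, smul_dotProduct]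
    change Q.rep ⬝ᵥ g.rep = 0 at hg
    change Q'.rep ⬝ᵥ g.rep = 0 at hg'
    rw [hg, hg']
    simp

/-- Let `λ` be a `k`-net (`k ≥ 4`) of order `n` embedded in `PG(2,K)` whose first
component is contained in a line pencil. If some other component is also contained in a
line pencil, then every component `λ_i` is contained in a line pencil with base point
`Q_i`, and the base points `Q_1, …, Q_k` are collinear. -/
theorem pencil_components_collinear_base_points {K : Type*} [Field K]
    (k n : ℕ) (hk : 4 ≤ k) (Λ : Fin k → Finset (PGLine K)) (hnet : IsNet K k n Λ)
    (Q₁ : PGPoint K) (hQ₁ : ∀ l ∈ Λ ⟨0, by omega⟩, Incident Q₁ l)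
    (j : Fin k) (hj : j ≠ ⟨0, by omega⟩)
    (Qj : PGPoint K) (hQj : ∀ l ∈ Λ j, Incident Qj l) :
    ∃ Q : Fin k → PGPoint K,
      (∀ i, ∀ l ∈ Λ i, Incident (Q i) l) ∧
      ∃ m : PGLine K, ∀ i, Incident (Q i) m := by
  have hj' := hj.symm
  have h0 : ∃ z : Fin k, z = ⟨0, by omega⟩ := ⟨_, rfl⟩
  obtain ⟨z, hz⟩ := h0
  rw [← hz] at hQ₁ hj'
  rcases Nat.lt_or_ge n 2 with hn | hn
  · obtain ⟨P, hP⟩ : ∃ P : PGPoint K, ∀ i, ∀ l ∈ Λ i, Incident P l := by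
      rcases Nat.eq_zero_or_pos n with h0 | h0
      · refine ⟨Q₁, fun i l hl => ?_⟩
        have := hnet.card_eq i
        rw [h0, Finset.card_eq_zero] at this
        simp [this] at hl
      · have ne : ∀ m, (Λ m).Nonempty := fun m => by
          rw [← Finset.card_pos, hnet.card_eq]; omega
        obtain ⟨a, ha⟩ := ne z
        obtain ⟨b, hb⟩ := ne j
        obtain ⟨P, -, -, h3⟩ := hnet.meets z j hj' a ha b hb
        refine ⟨P, fun i l hl => ?_⟩
        obtain ⟨x, ⟨hx, hxP⟩, -⟩ := h3 i
        have hc : (Λ i).card ≤ 1 := by rw [hnet.card_eq]; omega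
        rw [Finset.card_le_one.1 hc l hl x hx]
        exact hxP
    obtain ⟨g, hg, -⟩ := aux_line P P
    exact ⟨fun _ => P, hP, g, fun _ => hg⟩
  · obtain ⟨g, hg, hg'⟩ := aux_line Q₁ Qj
    have hQQ : Q₁ ≠ Qj := by
      have ne : (Λ j).Nonempty := by
        rw [← Finset.card_pos, hnet.card_eq]; omega
      obtain ⟨b, hb⟩ := ne
      rintro rfl
      exact aux_not hnet hn hj' hQ₁ hb (hQj b hb)
    have : ∀ i, ∃ R : PGPoint K, (∀ l ∈ Λ i, Incident R l) ∧ Incident R g := by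
      intro i
      by_cases h1 : z = i
      · subst h1; exact ⟨Q₁, hQ₁, hg⟩
      by_cases h2 : j = i
      · subst h2; exact ⟨Qj, hQj, hg'⟩
      exact aux_base hk hnet hn hj' h1 h2 g hg hg' hQ₁ hQj hQQ
    choose Q hQ using this
    exact ⟨Q, fun i => (hQ i).1, g, fun i => (hQ i).2⟩
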